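/- For every n ≥ 1 and every δ ∈ (0,1), the worst-case Lipschitz constant of δ-perturbed 2n-player 2-action anonymous games satisfies λ(2n,2,δ) = (1-δ)·P(S_{n-1}^{δ(1-δ/2)} = 0), where (S_m^r) is the lazy symmetric random walk on ℤ with rate r. -/

import Mathlib

open Finset

/-- `perturbW k δ a j` is the probability that the `δ`-perturbation of the pure
action `a ∈ [k]` plays the action `j`: with probability `1-δ` play `a`, with
probability `δ` play uniformly in `[k]`. -/
noncomputable def perturbW (k : ℕ) (δ : ℝ) (a j : Fin k) : ℝ :=
  (1 - δ) * (if j = a then 1 else 0) + δ / k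

/-- Probability that the (independent) `δ`-perturbation of the pure profile `a`
realises as the pure profile `b`. -/
noncomputable def profW (n k : ℕ) (δ : ℝ) (a b : Fin n → Fin k) : ℝ :=
  ∏ i, perturbW k δ (a i) (b i)

/-- A game: payoffs lie in `[0,1]`. -/
def IsGame (n k : ℕ) (g : (Fin n → Fin k) → Fin n → ℝ) : Prop :=
  ∀ a i, g a i ∈ Set.Icc (0 : ℝ) 1

/-- The number of players taking action `j` in the profile `a`. -/
def actCount (n k : ℕ) (a : Fin n → Fin k) (j : Fin k) : ℕ :=
  (Finset.univ.filter fun i => a i = j).card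

/-- A game is anonymous if each player's payoff depends only on his own action and
on the number of players taking each action. -/
def IsAnonymous (n k : ℕ) (g : (Fin n → Fin k) → Fin n → ℝ) : Prop :=
  ∀ (a b : Fin n → Fin k) (i : Fin n), a i = b i →
    (∀ j, actCount n k a j = actCount n k b j) → g a i = g b i

/-- The `δ`-perturbed game `g^δ`. -/
noncomputable def perturbGame (n k : ℕ) (δ : ℝ) (g : (Fin n → Fin k) → Fin n → ℝ) :
    (Fin n → Fin k) → Fin n → ℝ :=
  fun a i => ∑ b : Fin n → Fin k, profW n k δ a b * g b i

/-- The Lipschitz constant of a game: the largest change of some player's payoff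
when a single opponent changes his action. -/
noncomputable def lipC (n k : ℕ) (g : (Fin n → Fin k) → Fin n → ℝ) : ℝ :=
  sSup {x | ∃ (i : Fin n) (a b : Fin n → Fin k), a i = b i ∧
    (Finset.univ.filter fun j => a j ≠ b j).card = 1 ∧ x = |g a i - g b i|}

/-- The worst-case Lipschitz constant of `δ`-perturbed `n`-player `k`-action
anonymous games. -/
noncomputable def lam (n k : ℕ) (δ : ℝ) : ℝ :=
  sSup {x | ∃ g : (Fin n → Fin k) → Fin n → ℝ,
    IsGame n k g ∧ IsAnonymous n k g ∧ x = lipC n k (perturbGame n k δ g)}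
/-- `walk r m z` is the probability that the lazy symmetric random walk on `ℤ` with
rate `r` (i.i.d. increments: `0` w.p. `1-r`, `±1` w.p. `r/2` each), started at `0`,
is at `z` after `m` steps; i.e. `P(S_m^r = z)`. -/
noncomputable def walk (r : ℝ) : ℕ → ℤ → ℝ
  | 0, z => if z = 0 then 1 else 0
  | m + 1, z => (1 - r) * walk r m z + r / 2 * walk r m (z - 1) + r / 2 * walk r m (z + 1)

open Polynomial in
/-- The generating polynomial of the indicator that a perturbed action equals `1`. -/
noncomputable def actionPoly (δ : ℝ) (a : Fin 2) : ℝ[X] :=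
  C (perturbW 2 δ a 0) + C (perturbW 2 δ a 1) * X

open Polynomial in
/-- The generating polynomial of one step of the lazy random walk, shifted by one. -/
noncomputable def stepPoly (r : ℝ) : ℝ[X] :=
  C (r / 2) + C (1 - r) * X + C (r / 2) * X ^ 2

/-- The expectation of `f` under the signed measure with generating polynomial `p`,
truncated to `{0, …, N - 1}`. -/
noncomputable def pairing (N : ℕ) (f : ℕ → ℝ) (p : Polynomial ℝ) : ℝ :=
  ∑ k ∈ range N, p.coeff k * f k

/-- The number of players other than `i` taking action `1`. -/
def othersCount (N : ℕ) (i : Fin N) (b : Fin N → Fin 2) : ℕ :=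
  ((univ.erase i).filter fun k => b k = 1).card

section LogConcave

/-- Log-concavity of a sequence without internal zeros. -/
def StronglyLogConcave (c : ℕ → ℝ) : Prop :=
  (∀ i, 0 ≤ c i) ∧ ∀ i j, i ≤ j → c i * c (j + 2) ≤ c (i + 1) * c (j + 1)

open Polynomial in
lemma coeff_linear_mul_zero (s t : ℝ) (p : ℝ[X]) :
    ((C s + C t * X) * p).coeff 0 = s * p.coeff 0 := by
  simp [add_mul, mul_assoc]

open Polynomial in
lemma coeff_linear_mul_succ (s t : ℝ) (p : ℝ[X]) (k : ℕ) :
    ((C s + C t * X) * p).coeff (k + 1) = s * p.coeff (k + 1) + t * p.coeff k := by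
  simp [add_mul, mul_assoc]

open Polynomial in
lemma StronglyLogConcave.linear_mul {s t : ℝ} (hs : 0 ≤ s) (ht : 0 ≤ t) {p : ℝ[X]}
    (hp : StronglyLogConcave p.coeff) :
    StronglyLogConcave ((C s + C t * X) * p).coeff := by
  obtain ⟨h0, h⟩ := hp
  refine ⟨?_, ?_⟩
  · rintro (_ | i)
    · rw [coeff_linear_mul_zero]
      exact mul_nonneg hs (h0 _)
    · rw [coeff_linear_mul_succ]
      exact add_nonneg (mul_nonneg hs (h0 _)) (mul_nonneg ht (h0 _))
  · rintro (_ | i) j hij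
    · rw [coeff_linear_mul_zero, coeff_linear_mul_succ, coeff_linear_mul_succ]
      rcases j with _ | j
      · rw [coeff_linear_mul_succ]
        have h1 := mul_le_mul_of_nonneg_left (h 0 0 le_rfl) (mul_nonneg hs hs)
        have h2 := mul_nonneg (mul_nonneg hs ht) (mul_nonneg (h0 0) (h0 1))
        have h3 := mul_nonneg (mul_nonneg ht ht) (mul_nonneg (h0 0) (h0 0))
        simp only [zero_add] at *
        nlinarith
      · rw [coeff_linear_mul_succ]
        have h1 := mul_le_mul_of_nonneg_left (h 0 (j + 1) (by omega)) (mul_nonneg hs hs)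
        have h2 := mul_nonneg (mul_nonneg hs ht) (mul_nonneg (h0 1) (h0 (j + 1)))
        have h3 := mul_nonneg (mul_nonneg ht ht) (mul_nonneg (h0 0) (h0 (j + 1)))
        simp only [zero_add] at *
        nlinarith
    · obtain ⟨j, rfl⟩ : ∃ l, j = l + 1 := ⟨j - 1, by omega⟩
      simp only [coeff_linear_mul_succ]
      have h1 := mul_le_mul_of_nonneg_left (h (i + 1) (j + 1) hij) (mul_nonneg hs hs)
      have h2 := mul_le_mul_of_nonneg_left (h i j (by omega)) (mul_nonneg ht ht)
      have h3 : p.coeff i * p.coeff (j + 3) ≤ p.coeff (i + 2) * p.coeff (j + 1) := by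
        have e1 := h i (j + 1) (by omega)
        rcases eq_or_lt_of_le hij with hij | hij
        · obtain rfl : i = j := by omega
          linarith
        · have e2 := h (i + 1) j (by omega)
          exact e1.trans e2
      have h4 := mul_le_mul_of_nonneg_left h3 (mul_nonneg hs ht)
      simp only [add_assoc, Nat.reduceAdd] at *
      nlinarith

lemma StronglyLogConcave.antitone_after_drop {c : ℕ → ℝ} (h : StronglyLogConcave c) {i j : ℕ}
    (hij : i ≤ j) (hi : c (i + 1) < c i) : c (j + 1) ≤ c j := by
  rcases eq_or_lt_of_le hij with rfl | hij
  · exact hi.le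
  · obtain ⟨l, rfl⟩ : ∃ l, j = l + 1 := ⟨j - 1, by omega⟩
    by_contra! hj
    have h1 := h.2 i l (by omega)
    have h2 : c (i + 1) * c (l + 1) < c i * c (l + 2) :=
      mul_lt_mul'' hi hj (h.1 _) (h.1 _)
    linarith

open Polynomial in
lemma coeff_mul_X_sub_one_succ (p : ℝ[X]) (k : ℕ) :
    (p * (X - 1)).coeff (k + 1) = p.coeff k - p.coeff (k + 1) := by
  simp [mul_sub]

open Polynomial in
lemma coeff_mul_X_sub_one_zero (p : ℝ[X]) : (p * (X - 1)).coeff 0 = - p.coeff 0 := by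
  simp [mul_sub]

open Polynomial in
lemma pairing_mul_X_sub_one_le {p : ℝ[X]} (hp : StronglyLogConcave p.coeff) {M : ℝ}
    (hM : ∀ k, p.coeff k ≤ M) {f : ℕ → ℝ} (hf : ∀ k, f k ∈ Set.Icc (0 : ℝ) 1) (N : ℕ) :
    pairing N f (p * (X - 1)) ≤ M := by
  have hM0 : 0 ≤ M := (hp.1 0).trans (hM 0)
  have hneg : ∀ k, (p * (X - 1)).coeff k ≤ 0 → (p * (X - 1)).coeff k * f k ≤ 0 :=
    fun k hk => mul_nonpos_of_nonpos_of_nonneg hk (hf k).1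
  by_cases hd : ∃ i, p.coeff (i + 1) < p.coeff i
  · classical
    obtain ⟨i, hi, hmin⟩ : ∃ i, p.coeff (i + 1) < p.coeff i ∧
        ∀ j < i, p.coeff j ≤ p.coeff (j + 1) :=
      ⟨Nat.find hd, Nat.find_spec hd, fun j hj => not_lt.1 (Nat.find_min hd hj)⟩
    have key : ∀ N, pairing N f (p * (X - 1)) ≤
        if N ≤ i + 1 then 0 else p.coeff i - p.coeff (N - 1) := by
      intro N
      induction N with
      | zero => simp [pairing]
      | succ N ih =>
        unfold pairing at ih ⊢
        rw [sum_range_succ]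
        rcases N with _ | N
        · rw [if_pos (by omega)]
          have := hneg 0 (by rw [coeff_mul_X_sub_one_zero]; linarith [hp.1 0])
          rw [if_pos (by omega)] at ih
          linarith
        · rcases lt_or_ge N i with hN | hN
          · rw [if_pos (by omega)] at ih ⊢
            have := hneg (N + 1) (by rw [coeff_mul_X_sub_one_succ]; linarith [hmin N hN])
            linarith
          · have h1 := hp.antitone_after_drop hN hi
            have h2 : (p * (X - 1)).coeff (N + 1) * f (N + 1) ≤ p.coeff N - p.coeff (N + 1) := by
              rw [coeff_mul_X_sub_one_succ]
              exact mul_le_of_le_one_right (by linarith) (hf _).2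
            rw [if_neg (by omega)]
            simp only [Nat.add_sub_cancel] at ih ⊢
            split_ifs at ih with h3
            · obtain rfl : N = i := by omega
              linarith
            · linarith
    refine (key N).trans ?_
    split_ifs
    · exact hM0
    · linarith [hM i, hp.1 (N - 1)]
  · push Not at hd
    refine le_trans (sum_nonpos fun k _ => hneg k ?_) hM0
    rcases k with _ | k
    · rw [coeff_mul_X_sub_one_zero]
      linarith [hp.1 0]
    · rw [coeff_mul_X_sub_one_succ]
      linarith [hd k]

open Polynomial in
lemma sum_coeff_mul_X_sub_one (p : ℝ[X]) (N : ℕ) :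
    ∑ k ∈ range (N + 1), (p * (X - 1)).coeff k = - p.coeff N := by
  induction N with
  | zero => rw [sum_range_one, coeff_mul_X_sub_one_zero]
  | succ N ih =>
    rw [sum_range_succ, ih, coeff_mul_X_sub_one_succ]
    ring

open Polynomial in
lemma abs_pairing_mul_X_sub_one_le {p : ℝ[X]} (hp : StronglyLogConcave p.coeff) {M : ℝ}
    (hM : ∀ k, p.coeff k ≤ M) {f : ℕ → ℝ} (hf : ∀ k, f k ∈ Set.Icc (0 : ℝ) 1) {N : ℕ}
    (hN : p.coeff N = 0) :
    |pairing (N + 1) f (p * (X - 1))| ≤ M := by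
  refine abs_le.2 ⟨?_, pairing_mul_X_sub_one_le hp hM hf _⟩
  have h1 := pairing_mul_X_sub_one_le hp hM (f := fun k => 1 - f k)
    (fun k => ⟨by linarith [(hf k).2], by linarith [(hf k).1]⟩) (N + 1)
  have h2 : pairing (N + 1) (fun k => 1 - f k) (p * (X - 1)) =
      - pairing (N + 1) f (p * (X - 1)) := by
    simp only [pairing, mul_sub, mul_one, sum_sub_distrib]
    have := sum_coeff_mul_X_sub_one p N
    simp only [mul_sub, mul_one] at this
    rw [this, hN]
    ring
  linarith

open Polynomial in
lemma pairing_threshold (p : ℝ[X]) {m N : ℕ} (hmN : m ≤ N) :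
    pairing (N + 1) (fun k => if m + 1 ≤ k then 1 else 0) (p * (X - 1)) =
      p.coeff m - p.coeff N := by
  induction N, hmN using Nat.le_induction with
  | base =>
    rw [sub_self]
    refine sum_eq_zero fun k hk => ?_
    rw [mem_range] at hk
    simp only [if_neg (show ¬ m + 1 ≤ k by omega), mul_zero]
  | succ N hN ih =>
    unfold pairing at ih ⊢
    rw [sum_range_succ, ih, coeff_mul_X_sub_one_succ]
    simp only [if_pos (show m + 1 ≤ N + 1 by omega)]
    ring

end LogConcave

section ActionPoly

open Polynomial

lemma perturbW_nonneg {δ : ℝ} (hδ : δ ∈ Set.Ioo (0 : ℝ) 1) (a j : Fin 2) :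
    0 ≤ perturbW 2 δ a j := by
  have h1 := hδ.1
  have h2 := hδ.2
  unfold perturbW
  split_ifs <;> push_cast <;> linarith

lemma sum_perturbW (δ : ℝ) (a : Fin 2) : ∑ j, perturbW 2 δ a j = 1 := by
  fin_cases a <;> simp [perturbW] <;> ring

lemma natDegree_actionPoly_le (δ : ℝ) (a : Fin 2) : (actionPoly δ a).natDegree ≤ 1 := by
  unfold actionPoly
  compute_degree

lemma natDegree_prod_actionPoly_le {ι : Type*} (δ : ℝ) (a : ι → Fin 2) (s : Finset ι) :
    (∏ k ∈ s, actionPoly δ (a k)).natDegree ≤ s.card := by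
  refine (natDegree_prod_le s _).trans ?_
  refine (sum_le_sum fun k _ => natDegree_actionPoly_le δ (a k)).trans ?_
  simp

lemma stronglyLogConcave_prod_actionPoly {ι : Type*} {δ : ℝ} (hδ : δ ∈ Set.Ioo (0 : ℝ) 1)
    (a : ι → Fin 2) (s : Finset ι) :
    StronglyLogConcave (∏ k ∈ s, actionPoly δ (a k)).coeff := by
  classical
  induction s using Finset.induction_on with
  | empty =>
    rw [prod_empty]
    refine ⟨fun i => ?_, fun i j _ => ?_⟩
    · rw [coeff_one]
      split_ifs <;> norm_num
    · simp [coeff_one]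
  | insert k s hk ih =>
    rw [prod_insert hk]
    exact ih.linear_mul (perturbW_nonneg hδ _ _) (perturbW_nonneg hδ _ _)

lemma actionPoly_zero (δ : ℝ) : actionPoly δ 0 = C (1 - δ / 2) + C (δ / 2) * X := by
  unfold actionPoly
  congr 3 <;> simp [perturbW]
  ring

lemma actionPoly_one (δ : ℝ) : actionPoly δ 1 = C (δ / 2) + C (1 - δ / 2) * X := by
  unfold actionPoly
  congr 3 <;> simp [perturbW]
  ring

lemma actionPoly_mul_flip (δ : ℝ) :
    actionPoly δ 0 * actionPoly δ 1 = stepPoly (δ * (1 - δ / 2)) := by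
  have e : ∀ p q r s : ℝ, (C p + C q * X) * (C r + C s * X) =
      C (p * r) + C (p * s + q * r) * X + C (q * s) * X ^ 2 := by
    intro p q r s
    simp only [C_mul, C_add]
    ring
  rw [actionPoly_zero, actionPoly_one, stepPoly, e]
  congr 3
  · ring
  · congr 1
    ring
  · ring

lemma reflect_one_linear (s t : ℝ) : reflect 1 (C s + C t * X) = C t + C s * X := by
  have h := reflect_C_mul_X_pow 1 1 (c := t)
  rw [revAt_le le_rfl, Nat.sub_self, pow_zero, mul_one, pow_one] at h
  rw [reflect_add, reflect_C, h, pow_one, add_comm]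

lemma actionPoly_mul_reflect (δ : ℝ) (a : Fin 2) :
    actionPoly δ a * reflect 1 (actionPoly δ a) = stepPoly (δ * (1 - δ / 2)) := by
  fin_cases a
  · change actionPoly δ 0 * reflect 1 (actionPoly δ 0) = _
    rw [← actionPoly_mul_flip, actionPoly_zero, reflect_one_linear, ← actionPoly_one]
  · change actionPoly δ 1 * reflect 1 (actionPoly δ 1) = _
    rw [← actionPoly_mul_flip, mul_comm, actionPoly_one, reflect_one_linear, ← actionPoly_zero]

lemma prod_actionPoly_mul_reflect {ι : Type*} (δ : ℝ) (a : ι → Fin 2) (s : Finset ι) :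
    (∏ k ∈ s, actionPoly δ (a k)) * reflect s.card (∏ k ∈ s, actionPoly δ (a k)) =
      stepPoly (δ * (1 - δ / 2)) ^ s.card := by
  classical
  induction s using Finset.induction_on with
  | empty => simp
  | insert k s hk ih =>
    rw [prod_insert hk, card_insert_of_notMem hk, add_comm s.card 1,
      reflect_mul _ _ (natDegree_actionPoly_le δ (a k)) (natDegree_prod_actionPoly_le δ a s),
      pow_add, ← ih, pow_one, ← actionPoly_mul_reflect δ (a k)]
    ring

lemma coeff_stepPoly_mul (r : ℝ) (p : ℝ[X]) (k : ℕ) :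
    (stepPoly r * p).coeff k = r / 2 * p.coeff k
      + (1 - r) * (if 1 ≤ k then p.coeff (k - 1) else 0)
      + r / 2 * (if 2 ≤ k then p.coeff (k - 2) else 0) := by
  unfold stepPoly
  rw [add_mul, add_mul, mul_assoc, mul_assoc, coeff_add, coeff_add, coeff_C_mul, coeff_C_mul,
    coeff_C_mul, coeff_X_pow_mul']
  congr 3
  simpa using coeff_X_pow_mul' p 1 k

lemma walk_eq_zero (r : ℝ) (m : ℕ) (z : ℤ) (hz : z < -m) : walk r m z = 0 := by
  induction m generalizing z with
  | zero =>
    unfold walk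
    rw [if_neg (by simp at hz; omega)]
  | succ m ih =>
    push_cast at hz
    simp [walk, ih z (by omega), ih (z - 1) (by omega), ih (z + 1) (by omega)]

lemma coeff_stepPoly_pow (r : ℝ) (m k : ℕ) :
    (stepPoly r ^ m).coeff k = walk r m ((k : ℤ) - m) := by
  induction m generalizing k with
  | zero => simp [walk, coeff_one]
  | succ m ih =>
    rw [pow_succ', coeff_stepPoly_mul]
    simp only [ih, walk]
    have e0 : ((k : ℤ) - (m + 1 : ℕ) + 1) = k - m := by push_cast; ring
    have e1 : (if 1 ≤ k then walk r m (((k - 1 : ℕ) : ℤ) - m) else 0) =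
        walk r m ((k : ℤ) - (m + 1 : ℕ)) := by
      split_ifs with h
      · congr 1; omega
      · rw [walk_eq_zero r m _ (by omega)]
    have e2 : (if 2 ≤ k then walk r m (((k - 2 : ℕ) : ℤ) - m) else 0) =
        walk r m ((k : ℤ) - (m + 1 : ℕ) - 1) := by
      split_ifs with h
      · congr 1; omega
      · rw [walk_eq_zero r m _ (by omega)]
    rw [e0, e1, e2]
    ring

lemma sum_sq_coeff_prod_actionPoly {ι : Type*} (δ : ℝ) (a : ι → Fin 2) (s : Finset ι) :
    ∑ k ∈ range (s.card + 1), (∏ l ∈ s, actionPoly δ (a l)).coeff k ^ 2 =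
      walk (δ * (1 - δ / 2)) s.card 0 := by
  have h := congrArg (fun p => p.coeff s.card) (prod_actionPoly_mul_reflect δ a s)
  simp only [coeff_stepPoly_pow, sub_self, coeff_mul] at h
  rw [← h, Nat.sum_antidiagonal_eq_sum_range_succ_mk]
  refine sum_congr rfl fun k hk => ?_
  rw [mem_range] at hk
  rw [coeff_reflect, revAt_le (by omega), Nat.sub_sub_self (by omega), sq]

lemma sum_sq_coeff_le {p : ℝ[X]} {m : ℕ} (hp : p.natDegree ≤ m) (x : ℕ) :
    ∑ k ∈ range (x + 1), p.coeff k ^ 2 ≤ ∑ k ∈ range (m + 1), p.coeff k ^ 2 := by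
  rcases le_total x m with h | h
  · exact sum_le_sum_of_subset_of_nonneg (range_subset_range.2 (by omega))
      fun _ _ _ => sq_nonneg _
  · refine (sum_subset (range_subset_range.2 (by omega)) fun k _ hk => ?_).ge
    rw [mem_range] at hk
    rw [coeff_eq_zero_of_natDegree_lt (by omega)]
    norm_num

lemma coeff_mul_le_of_sum_sq {p q : ℝ[X]} {m : ℕ} (hp : p.natDegree ≤ m) (hq : q.natDegree ≤ m)
    {M : ℝ} (hpM : ∑ k ∈ range (m + 1), p.coeff k ^ 2 = M)
    (hqM : ∑ k ∈ range (m + 1), q.coeff k ^ 2 = M) (x : ℕ) : (p * q).coeff x ≤ M := by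
  have h1 := sum_sq_coeff_le hp x
  have h2 := sum_sq_coeff_le hq x
  rw [← sum_range_reflect] at h2
  rw [coeff_mul, Nat.sum_antidiagonal_eq_sum_range_succ_mk]
  have h3 : ∑ k ∈ range (x + 1), p.coeff k * q.coeff (x - k) ≤
      ∑ k ∈ range (x + 1), (p.coeff k ^ 2 / 2 + q.coeff (x + 1 - 1 - k) ^ 2 / 2) := by
    refine sum_le_sum fun k _ => ?_
    rw [Nat.add_sub_cancel]
    nlinarith [sq_nonneg (p.coeff k - q.coeff (x - k))]
  rw [sum_add_distrib, ← sum_div, ← sum_div] at h3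
  exact h3.trans (by linarith)

lemma coeff_prod_actionPoly_le {ι : Type*} (δ : ℝ) (a : ι → Fin 2) {s : Finset ι} {m : ℕ}
    (hs : s.card = 2 * m) (x : ℕ) :
    (∏ k ∈ s, actionPoly δ (a k)).coeff x ≤ walk (δ * (1 - δ / 2)) m 0 := by
  classical
  obtain ⟨t, hts, ht⟩ := exists_subset_card_eq (show m ≤ s.card by omega)
  have ht' : (s \ t).card = m := by
    rw [card_sdiff_of_subset hts]
    omega
  rw [← prod_sdiff hts]
  refine coeff_mul_le_of_sum_sq (m := m) ?_ ?_ ?_ ?_ x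
  · exact (natDegree_prod_actionPoly_le δ a _).trans ht'.le
  · exact (natDegree_prod_actionPoly_le δ a _).trans ht.le
  · simpa only [ht'] using sum_sq_coeff_prod_actionPoly δ a (s \ t)
  · simpa only [ht] using sum_sq_coeff_prod_actionPoly δ a t

lemma prod_actionPoly_balanced {ι : Type*} [DecidableEq ι] (δ : ℝ) (a : ι → Fin 2)
    {s t : Finset ι} {m : ℕ} (hs : s.card = 2 * m) (hts : t ⊆ s) (ht : t.card = m)
    (h0 : ∀ k ∈ s \ t, a k = 0) (h1 : ∀ k ∈ t, a k = 1) :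
    ∏ k ∈ s, actionPoly δ (a k) = stepPoly (δ * (1 - δ / 2)) ^ m := by
  have ht' : (s \ t).card = m := by
    rw [card_sdiff_of_subset hts]
    omega
  rw [← prod_sdiff hts, prod_congr rfl fun k hk => congrArg (actionPoly δ) (h0 k hk),
    prod_congr rfl fun k hk => congrArg (actionPoly δ) (h1 k hk), prod_const, prod_const, ht, ht',
    ← mul_pow, actionPoly_mul_flip]

end ActionPoly

section Pairing

open Polynomial

lemma pairing_sum {ι : Type*} (N : ℕ) (f : ℕ → ℝ) (s : Finset ι) (p : ι → ℝ[X]) :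
    pairing N f (∑ i ∈ s, p i) = ∑ i ∈ s, pairing N f (p i) := by
  simp only [pairing, finsetSum_coeff, sum_mul]
  exact sum_comm

lemma pairing_C_mul (N : ℕ) (f : ℕ → ℝ) (c : ℝ) (p : ℝ[X]) :
    pairing N f (C c * p) = c * pairing N f p := by
  simp only [pairing, coeff_C_mul, mul_sum, mul_assoc]

lemma pairing_sub (N : ℕ) (f : ℕ → ℝ) (p q : ℝ[X]) :
    pairing N f (p - q) = pairing N f p - pairing N f q := by
  simp only [pairing, coeff_sub, sub_mul, sum_sub_distrib]

lemma pairing_X_pow {N k : ℕ} (hk : k < N) (f : ℕ → ℝ) : pairing N f (X ^ k) = f k := by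
  simp [pairing, coeff_X_pow, hk]

lemma othersCount_lt {N : ℕ} (i : Fin N) (b : Fin N → Fin 2) : othersCount N i b < N := by
  refine (card_filter_le _ _).trans_lt ?_
  rw [card_erase_of_mem (mem_univ i), card_univ, Fintype.card_fin]
  have := i.pos
  omega

lemma sum_profW_othersCount {N : ℕ} (δ : ℝ) (a : Fin N → Fin 2) (i : Fin N) (c : Fin 2) :
    ∑ b : Fin N → Fin 2, C (profW N 2 δ a b * if b i = c then 1 else 0) * X ^ othersCount N i b =
      C (perturbW 2 δ (a i) c) * ∏ k ∈ univ.erase i, actionPoly δ (a k) := by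
  let φ : Fin N → Fin 2 → ℝ[X] := fun k j =>
    C (perturbW 2 δ (a k) j) *
      if k = i then (if j = c then 1 else 0) else (if j = 1 then X else 1)
  have h1 : ∏ k, ∑ j, φ k j =
      C (perturbW 2 δ (a i) c) * ∏ k ∈ univ.erase i, actionPoly δ (a k) := by
    rw [← mul_prod_erase univ _ (mem_univ i)]
    congr 1
    · simp [φ]
    · refine prod_congr rfl fun k hk => ?_
      simp [φ, (mem_erase.1 hk).1, actionPoly]
  rw [← h1, prod_univ_sum, Fintype.piFinset_univ]
  refine sum_congr rfl fun b _ => ?_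
  simp only [φ, prod_mul_distrib]
  rw [C_mul, mul_assoc, profW, map_prod]
  congr 1
  rw [← mul_prod_erase univ _ (mem_univ i), if_pos rfl]
  congr 1
  · split_ifs <;> simp
  · rw [prod_congr rfl fun k hk => if_neg (mem_erase.1 hk).1, prod_ite, prod_const, prod_const_one,
      mul_one, othersCount]

lemma perturbGame_eq {N : ℕ} (δ : ℝ) {g : (Fin N → Fin 2) → Fin N → ℝ} {i : Fin N}
    {F : Fin 2 → ℕ → ℝ} (hF : ∀ b, g b i = F (b i) (othersCount N i b)) (a : Fin N → Fin 2) :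
    perturbGame N 2 δ g a i = ∑ c, perturbW 2 δ (a i) c *
      pairing N (F c) (∏ k ∈ univ.erase i, actionPoly δ (a k)) := by
  simp only [← pairing_C_mul, ← sum_profW_othersCount, pairing_sum]
  rw [sum_comm]
  refine sum_congr rfl fun b _ => ?_
  simp only [pairing_C_mul, pairing_X_pow (othersCount_lt i b), hF]
  simp

lemma perturbGame_sub {N : ℕ} (δ : ℝ) {g : (Fin N → Fin 2) → Fin N → ℝ} {i j : Fin N}
    {F : Fin 2 → ℕ → ℝ} (hF : ∀ b, g b i = F (b i) (othersCount N i b)) {a b : Fin N → Fin 2}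
    (hij : j ≠ i) (hab : ∀ k, k ≠ j → a k = b k) (haj : a j = 1) (hbj : b j = 0) :
    perturbGame N 2 δ g a i - perturbGame N 2 δ g b i = (1 - δ) * ∑ c, perturbW 2 δ (a i) c *
      pairing N (F c) ((∏ k ∈ (univ.erase i).erase j, actionPoly δ (a k)) * (X - 1)) := by
  have hj : j ∈ univ.erase i := mem_erase.2 ⟨hij, mem_univ j⟩
  have hd : actionPoly δ 1 - actionPoly δ 0 = C (1 - δ) * (X - 1) := by
    simp only [actionPoly, perturbW]
    simp
    ring
  have hprod : ∏ k ∈ (univ.erase i).erase j, actionPoly δ (b k) =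
      ∏ k ∈ (univ.erase i).erase j, actionPoly δ (a k) :=
    prod_congr rfl fun k hk => by rw [hab k (mem_erase.1 hk).1]
  rw [perturbGame_eq δ hF, perturbGame_eq δ hF, ← hab i hij.symm, ← sum_sub_distrib, mul_sum]
  refine sum_congr rfl fun c _ => ?_
  rw [← mul_sub, ← pairing_sub, ← mul_prod_erase _ _ hj, ← mul_prod_erase _ _ hj, hprod, haj, hbj,
    ← sub_mul, hd, mul_assoc, pairing_C_mul, mul_comm (X - 1)]
  ring

end Pairing

section Games

lemma actCount_one {N : ℕ} (i : Fin N) (b : Fin N → Fin 2) :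
    actCount N 2 b 1 = othersCount N i b + if b i = 1 then 1 else 0 := by
  unfold actCount othersCount
  rw [filter_erase, card_erase_eq_ite]
  simp only [mem_filter, mem_univ, true_and]
  split_ifs with h
  · have : 0 < (univ.filter fun k => b k = 1).card := card_pos.2 ⟨i, by simp [h]⟩
    omega
  · rfl

lemma actCount_zero_add_one {N : ℕ} (b : Fin N → Fin 2) :
    actCount N 2 b 0 + actCount N 2 b 1 = N := by
  have h := card_filter_add_card_filter_not (s := (univ : Finset (Fin N))) (fun k => b k = 0)
  rw [card_univ, Fintype.card_fin] at h
  refine Eq.trans ?_ h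
  unfold actCount
  congr 3
  ext k
  generalize b k = x
  fin_cases x <;> simp

lemma IsAnonymous.exists_payoff {N : ℕ} {g : (Fin N → Fin 2) → Fin N → ℝ}
    (hg : IsGame N 2 g) (ha : IsAnonymous N 2 g) (i : Fin N) :
    ∃ F : Fin 2 → ℕ → ℝ, (∀ c x, F c x ∈ Set.Icc (0 : ℝ) 1) ∧
      ∀ b, g b i = F (b i) (othersCount N i b) := by
  classical
  refine ⟨fun c x => if h : ∃ b : Fin N → Fin 2, b i = c ∧ othersCount N i b = x
    then g h.choose i else 0, fun c x => ?_, fun b => ?_⟩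
  · dsimp only
    split_ifs
    · exact hg _ _
    · norm_num
  · have h : ∃ b' : Fin N → Fin 2, b' i = b i ∧ othersCount N i b' = othersCount N i b :=
      ⟨b, rfl, rfl⟩
    dsimp only
    rw [dif_pos h]
    obtain ⟨h1, h2⟩ := h.choose_spec
    have h3 : actCount N 2 b 1 = actCount N 2 h.choose 1 := by
      rw [actCount_one i, actCount_one i, h1, h2]
    refine ha _ _ _ h1.symm fun j => ?_
    have h4 := actCount_zero_add_one b
    have h5 := actCount_zero_add_one h.choose
    fin_cases j
    · change actCount N 2 b 0 = actCount N 2 h.choose 0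
      omega
    · exact h3

lemma card_erase_erase {m : ℕ} {i j : Fin (2 * (m + 1))} (hij : j ≠ i) :
    ((univ.erase i).erase j).card = 2 * m := by
  rw [card_erase_of_mem (mem_erase.2 ⟨hij, mem_univ j⟩), card_erase_of_mem (mem_univ i),
    card_univ, Fintype.card_fin]
  omega

lemma abs_perturbGame_sub_le {m : ℕ} {δ : ℝ} (hδ : δ ∈ Set.Ioo (0 : ℝ) 1)
    {g : (Fin (2 * (m + 1)) → Fin 2) → Fin (2 * (m + 1)) → ℝ} (hg : IsGame (2 * (m + 1)) 2 g)
    (ha : IsAnonymous (2 * (m + 1)) 2 g) {i j : Fin (2 * (m + 1))}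
    {a b : Fin (2 * (m + 1)) → Fin 2} (hij : j ≠ i) (hab : ∀ k, k ≠ j → a k = b k)
    (haj : a j = 1) (hbj : b j = 0) :
    |perturbGame _ 2 δ g a i - perturbGame _ 2 δ g b i| ≤
      (1 - δ) * walk (δ * (1 - δ / 2)) m 0 := by
  obtain ⟨F, hF01, hF⟩ := ha.exists_payoff hg i
  have hδ1 : 0 ≤ 1 - δ := by linarith [hδ.2]
  rw [perturbGame_sub δ hF hij hab haj hbj, abs_mul, abs_of_nonneg hδ1]
  refine mul_le_mul_of_nonneg_left ?_ hδ1
  refine (abs_sum_le_sum_abs _ _).trans ?_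
  have hw : walk (δ * (1 - δ / 2)) m 0 =
      ∑ c, perturbW 2 δ (a i) c * walk (δ * (1 - δ / 2)) m 0 := by
    rw [← sum_mul, sum_perturbW, one_mul]
  rw [hw]
  refine sum_le_sum fun c _ => ?_
  rw [abs_mul, abs_of_nonneg (perturbW_nonneg hδ _ _)]
  refine mul_le_mul_of_nonneg_left ?_ (perturbW_nonneg hδ _ _)
  refine abs_pairing_mul_X_sub_one_le (N := 2 * m + 1) (stronglyLogConcave_prod_actionPoly hδ a _)
    (coeff_prod_actionPoly_le δ a (card_erase_erase hij)) (hF01 c) ?_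
  refine Polynomial.coeff_eq_zero_of_natDegree_lt ?_
  have := natDegree_prod_actionPoly_le δ a ((univ.erase i).erase j)
  rw [card_erase_erase hij] at this
  omega

lemma abs_sub_le_of_adjacent {m : ℕ} {δ : ℝ} (hδ : δ ∈ Set.Ioo (0 : ℝ) 1)
    {g : (Fin (2 * (m + 1)) → Fin 2) → Fin (2 * (m + 1)) → ℝ} (hg : IsGame (2 * (m + 1)) 2 g)
    (ha : IsAnonymous (2 * (m + 1)) 2 g) {i : Fin (2 * (m + 1))}
    {a b : Fin (2 * (m + 1)) → Fin 2} (hi : a i = b i)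
    (hab : (univ.filter fun j => a j ≠ b j).card = 1) :
    |perturbGame _ 2 δ g a i - perturbGame _ 2 δ g b i| ≤
      (1 - δ) * walk (δ * (1 - δ / 2)) m 0 := by
  obtain ⟨j, hj⟩ := card_eq_one.1 hab
  have hmem : ∀ k, a k ≠ b k ↔ k = j := fun k => by
    simpa using Finset.ext_iff.1 hj k
  have hne : a j ≠ b j := (hmem j).2 rfl
  have hab' : ∀ k, k ≠ j → a k = b k := fun k hk => by
    by_contra h
    exact hk ((hmem k).1 h)
  have hij : j ≠ i := by
    rintro rfl
    exact hne hi
  have hcases : (a j = 1 ∧ b j = 0) ∨ (b j = 1 ∧ a j = 0) := by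
    generalize a j = x at hne
    generalize b j = y at hne
    fin_cases x <;> fin_cases y <;> simp_all
  rcases hcases with ⟨h1, h0⟩ | ⟨h1, h0⟩
  · exact abs_perturbGame_sub_le hδ hg ha hij hab' h1 h0
  · rw [abs_sub_comm]
    exact abs_perturbGame_sub_le hδ hg ha hij (fun k hk => (hab' k hk).symm) h1 h0

lemma walk_nonneg {r : ℝ} (h0 : 0 ≤ r) (h1 : r ≤ 1) (m : ℕ) (z : ℤ) : 0 ≤ walk r m z := by
  induction m generalizing z with
  | zero =>
    unfold walk
    split_ifs <;> norm_num
  | succ m ih =>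
    unfold walk
    have := ih z
    have := ih (z - 1)
    have := ih (z + 1)
    have : 0 ≤ 1 - r := by linarith
    positivity

lemma lipC_perturbGame_le {m : ℕ} {δ : ℝ} (hδ : δ ∈ Set.Ioo (0 : ℝ) 1)
    {g : (Fin (2 * (m + 1)) → Fin 2) → Fin (2 * (m + 1)) → ℝ} (hg : IsGame (2 * (m + 1)) 2 g)
    (ha : IsAnonymous (2 * (m + 1)) 2 g) :
    lipC _ 2 (perturbGame _ 2 δ g) ≤ (1 - δ) * walk (δ * (1 - δ / 2)) m 0 := by
  have h1 := hδ.1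
  have h2 := hδ.2
  refine Real.sSup_le ?_ (mul_nonneg (by linarith) (walk_nonneg (by nlinarith) (by nlinarith) _ _))
  rintro x ⟨i, a, b, hi, hab, rfl⟩
  exact abs_sub_le_of_adjacent hδ hg ha hi hab

/-- Every player is paid `1` if more than `m` of the opponents take action `1`. -/
noncomputable def thresholdGame (m N : ℕ) (b : Fin N → Fin 2) (i : Fin N) : ℝ :=
  if m + 1 ≤ othersCount N i b then 1 else 0

lemma isGame_thresholdGame (m N : ℕ) : IsGame N 2 (thresholdGame m N) := by
  intro b i
  unfold thresholdGame
  split_ifs <;> norm_num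

lemma isAnonymous_thresholdGame (m N : ℕ) : IsAnonymous N 2 (thresholdGame m N) := by
  intro a b i hi hab
  have h := hab 1
  rw [actCount_one i, actCount_one i, hi] at h
  unfold thresholdGame
  rw [Nat.add_right_cancel h]

lemma le_lipC_thresholdGame (m : ℕ) {δ : ℝ} (hδ : δ ∈ Set.Ioo (0 : ℝ) 1) :
    (1 - δ) * walk (δ * (1 - δ / 2)) m 0 ≤
      lipC (2 * (m + 1)) 2 (perturbGame (2 * (m + 1)) 2 δ (thresholdGame m _)) := by
  let i : Fin (2 * (m + 1)) := ⟨0, by omega⟩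
  let j : Fin (2 * (m + 1)) := ⟨1, by omega⟩
  have hij : j ≠ i := by simp [i, j]
  have hs := card_erase_erase hij
  obtain ⟨t, hts, ht⟩ := exists_subset_card_eq
    (show m ≤ ((univ.erase i).erase j).card by omega)
  have hjt : j ∉ t := fun h => (mem_erase.1 (hts h)).1 rfl
  let b : Fin (2 * (m + 1)) → Fin 2 := fun k => if k ∈ t then 1 else 0
  let a : Fin (2 * (m + 1)) → Fin 2 := Function.update b j 1
  have haj : a j = 1 := Function.update_self ..
  have hbj : b j = 0 := if_neg hjt
  have hab : ∀ k, k ≠ j → a k = b k := fun k hk => Function.update_of_ne hk ..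
  have hdiff : (univ.filter fun k => a k ≠ b k) = {j} := by
    ext k
    by_cases hk : k = j
    · subst hk
      simp [haj, hbj]
    · simp [hk, hab k hk]
  have hQ : ∏ k ∈ (univ.erase i).erase j, actionPoly δ (a k) =
      stepPoly (δ * (1 - δ / 2)) ^ m := by
    refine prod_actionPoly_balanced δ a hs hts ht (fun k hk => ?_) fun k hk => ?_
    · obtain ⟨hk1, hk2⟩ := mem_sdiff.1 hk
      rw [hab k (mem_erase.1 hk1).1]
      exact if_neg hk2
    · rw [hab k (mem_erase.1 (hts hk)).1]
      exact if_pos hk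
  have hval : perturbGame _ 2 δ (thresholdGame m _) a i -
      perturbGame _ 2 δ (thresholdGame m _) b i = (1 - δ) * walk (δ * (1 - δ / 2)) m 0 := by
    rw [perturbGame_sub (F := fun _ x => if m + 1 ≤ x then 1 else 0) δ (fun _ => rfl) hij hab haj
      hbj, ← sum_mul, sum_perturbW, one_mul]
    congr 1
    have hdeg := natDegree_prod_actionPoly_le δ a ((univ.erase i).erase j)
    refine (pairing_threshold _ (N := 2 * m + 1) (by omega)).trans ?_
    rw [Polynomial.coeff_eq_zero_of_natDegree_lt (n := 2 * m + 1) (by omega), hQ,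
      coeff_stepPoly_pow, sub_self, sub_zero]
  refine le_trans (hval.symm.le.trans (le_abs_self _)) (le_csSup ?_ ?_)
  · refine ⟨(1 - δ) * walk (δ * (1 - δ / 2)) m 0, ?_⟩
    rintro x ⟨i, a, b, hi, hab, rfl⟩
    exact abs_sub_le_of_adjacent hδ (isGame_thresholdGame _ _) (isAnonymous_thresholdGame _ _)
      hi hab
  · exact ⟨i, a, b, hab i hij.symm, by rw [hdiff, card_singleton], rfl⟩

end Games

/-- For `n ≥ 1`, the worst-case Lipschitz constant of `δ`-perturbed `2n`-player
2-action anonymous games equals `(1-δ)·P(S_{n-1}^{δ(1-δ/2)} = 0)`. -/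
theorem lipschitz_constant_two_actions_even (n : ℕ) (hn : 1 ≤ n)
    (δ : ℝ) (hδ : δ ∈ Set.Ioo (0 : ℝ) 1) :
    lam (2 * n) 2 δ = (1 - δ) * walk (δ * (1 - δ / 2)) (n - 1) 0 := by
  obtain ⟨m, rfl⟩ : ∃ m, n = m + 1 := ⟨n - 1, by omega⟩
  rw [Nat.add_sub_cancel]
  refine IsGreatest.csSup_eq ⟨⟨thresholdGame m _, isGame_thresholdGame _ _,
    isAnonymous_thresholdGame _ _, (le_lipC_thresholdGame m hδ).antisymm
      (lipC_perturbGame_le hδ (isGame_thresholdGame _ _) (isAnonymous_thresholdGame _ _))⟩, ?_⟩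
  rintro x ⟨g, hg, ha, rfl⟩
  exact lipC_perturbGame_le hδ hg ha
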